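/- Let 1 < p < ∞, let Ω ⊆ ℝ^N be a domain of class C^{0,ω} with boundary Γ, and set ψ(t) = min_{0≤s≤r} √(s² + (t−ω(s))²) for t > 0 (r as in the C^{0,ω} definition, with ω(0) := 0). Let u be a bounded viscosity solution of problem (P) in Ω with 0 < u < 1 on Ω×(0,∞). Then for every compact set K ⊆ Ω̄ there exist C > 0 and t₀ > 0 such that |4t·log u(x,t) + p'·d_Γ(x)²| ≤ C·t·(1 + |log ψ(t)|) for all x ∈ K and 0 < t < t₀. In particular, if t·log ψ(t) → 0 as t → 0⁺, then 4t·log u(x,t) → −p'·d_Γ(x)² as t → 0⁺, uniformly on every compact subset of Ω̄. -/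

import Mathlib

open MeasureTheory Metric Set Filter
open scoped Topology ENNReal NNReal Real Classical

noncomputable section

/-- The Hessian matrix of a real-valued function, via the second iterated Fréchet derivative. -/
noncomputable def hess {N : ℕ} (f : EuclideanSpace ℝ (Fin N) → ℝ) (x : EuclideanSpace ℝ (Fin N)) :
    Matrix (Fin N) (Fin N) ℝ :=
  fun i j => iteratedFDeriv ℝ 2 f x ![EuclideanSpace.single i 1, EuclideanSpace.single j 1]

/-- The quadratic form ⟨Xv, v⟩ associated to a matrix. -/
noncomputable def qform {N : ℕ} (X : Matrix (Fin N) (Fin N) ℝ) (v : EuclideanSpace ℝ (Fin N)) : ℝ :=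
  ∑ i, ∑ j, X i j * v j * v i

/-- Smallest eigenvalue (via the Rayleigh quotient) of a symmetric matrix. -/
noncomputable def lamMin {N : ℕ} (X : Matrix (Fin N) (Fin N) ℝ) : ℝ :=
  sInf {r | ∃ v : EuclideanSpace ℝ (Fin N), ‖v‖ = 1 ∧ r = qform X v}

/-- Largest eigenvalue (via the Rayleigh quotient) of a symmetric matrix. -/
noncomputable def lamMax {N : ℕ} (X : Matrix (Fin N) (Fin N) ℝ) : ℝ :=
  sSup {r | ∃ v : EuclideanSpace ℝ (Fin N), ‖v‖ = 1 ∧ r = qform X v}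

/-- F(ξ, X) = (1/p)[tr X + (p−2)⟨Xξ,ξ⟩/|ξ|²]. -/
noncomputable def Fop {N : ℕ} (p : ℝ) (ξ : EuclideanSpace ℝ (Fin N))
    (X : Matrix (Fin N) (Fin N) ℝ) : ℝ :=
  (1/p) * (Matrix.trace X + (p - 2) * qform X ξ / ‖ξ‖^2)

/-- Lower semicontinuous relaxation F_*. -/
noncomputable def Flower {N : ℕ} (p : ℝ) (ξ : EuclideanSpace ℝ (Fin N))
    (X : Matrix (Fin N) (Fin N) ℝ) : ℝ :=
  if ξ = 0 then
    (1/p) * (Matrix.trace X + max (p - 2) 0 * lamMin X + min (p - 2) 0 * lamMax X)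
  else Fop p ξ X

/-- Upper semicontinuous relaxation F^*. -/
noncomputable def Fupper {N : ℕ} (p : ℝ) (ξ : EuclideanSpace ℝ (Fin N))
    (X : Matrix (Fin N) (Fin N) ℝ) : ℝ :=
  if ξ = 0 then
    (1/p) * (Matrix.trace X + min (p - 2) 0 * lamMin X + max (p - 2) 0 * lamMax X)
  else Fop p ξ X

/-- Viscosity solution of `u_t = Δ_p^G u` in `Ω × (0,∞)`. -/
def IsViscositySol {N : ℕ} (p : ℝ) (Ω : Set (EuclideanSpace ℝ (Fin N)))
    (u : EuclideanSpace ℝ (Fin N) → ℝ → ℝ) : Prop :=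
  ContinuousOn (fun q : EuclideanSpace ℝ (Fin N) × ℝ => u q.1 q.2) (Ω ×ˢ Set.Ioi 0) ∧
  (∀ φ : EuclideanSpace ℝ (Fin N) × ℝ → ℝ, ContDiff ℝ 2 φ →
    ∀ x ∈ Ω, ∀ t ∈ Set.Ioi (0:ℝ),
      IsLocalMaxOn (fun q : EuclideanSpace ℝ (Fin N) × ℝ => u q.1 q.2 - φ q)
        (Ω ×ˢ Set.Ioi 0) (x, t) →
      deriv (fun s => φ (x, s)) t ≤
        Fupper p (gradient (fun y => φ (y, t)) x) (hess (fun y => φ (y, t)) x)) ∧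
  (∀ φ : EuclideanSpace ℝ (Fin N) × ℝ → ℝ, ContDiff ℝ 2 φ →
    ∀ x ∈ Ω, ∀ t ∈ Set.Ioi (0:ℝ),
      IsLocalMinOn (fun q : EuclideanSpace ℝ (Fin N) × ℝ => u q.1 q.2 - φ q)
        (Ω ×ˢ Set.Ioi 0) (x, t) →
      Flower p (gradient (fun y => φ (y, t)) x) (hess (fun y => φ (y, t)) x) ≤
        deriv (fun s => φ (x, s)) t)

/-- Bounded (viscosity) solution of problem (P): `u_t = Δ_p^G u` in `Ω × (0,∞)`,
`u = 0` on `Ω × {0}`, `u = 1` on `Γ × (0,∞)`; continuous away from `Γ × {0}`. -/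
def IsSolP {N : ℕ} (p : ℝ) (Ω : Set (EuclideanSpace ℝ (Fin N)))
    (u : EuclideanSpace ℝ (Fin N) → ℝ → ℝ) : Prop :=
  (∃ M : ℝ, ∀ x ∈ closure Ω, ∀ t : ℝ, 0 ≤ t → |u x t| ≤ M) ∧
  (∀ x ∈ closure Ω, ∀ t : ℝ, 0 ≤ t → ¬(x ∈ frontier Ω ∧ t = 0) →
    ContinuousWithinAt (fun q : EuclideanSpace ℝ (Fin N) × ℝ => u q.1 q.2)
      (closure Ω ×ˢ Set.Ici 0) (x, t)) ∧
  IsViscositySol p Ω u ∧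
  (∀ x ∈ Ω, u x 0 = 0) ∧
  (∀ y ∈ frontier Ω, ∀ t : ℝ, 0 < t → u y t = 1)

/-- Viscosity solution of the elliptic equation `u − ε² Δ_p^G u = 0` in `Ω`. -/
def IsEllipticViscositySol {N : ℕ} (p ε : ℝ) (Ω : Set (EuclideanSpace ℝ (Fin N)))
    (u : EuclideanSpace ℝ (Fin N) → ℝ) : Prop :=
  ContinuousOn u Ω ∧
  (∀ φ : EuclideanSpace ℝ (Fin N) → ℝ, ContDiff ℝ 2 φ → ∀ x ∈ Ω,
      IsLocalMaxOn (fun y => u y - φ y) Ω x →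
      φ x - ε^2 * Fupper p (gradient φ x) (hess φ x) ≤ 0) ∧
  (∀ φ : EuclideanSpace ℝ (Fin N) → ℝ, ContDiff ℝ 2 φ → ∀ x ∈ Ω,
      IsLocalMinOn (fun y => u y - φ y) Ω x →
      0 ≤ φ x - ε^2 * Flower p (gradient φ x) (hess φ x))

/-- The complementary error function. -/
noncomputable def Erfc (σ : ℝ) : ℝ := (2 / Real.sqrt π) * ∫ τ in Set.Ioi σ, Real.exp (-τ^2)

/-- The explicit radially symmetric solution `u^ε` of the elliptic problem in the ball `B_R`. -/
noncomputable def uEps (N : ℕ) (p R ε : ℝ) (x : EuclideanSpace ℝ (Fin N)) : ℝ :=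
  (∫ θ in (0:ℝ)..π,
      Real.exp (Real.sqrt (p/(p-1)) * (‖x‖/ε) * Real.cos θ) * (Real.sin θ) ^ (((N:ℝ) - p)/(p-1))) /
  (∫ θ in (0:ℝ)..π,
      Real.exp (Real.sqrt (p/(p-1)) * (R/ε) * Real.cos θ) * (Real.sin θ) ^ (((N:ℝ) - p)/(p-1)))

/-- The first `N−1` coordinates of a point in the coordinate system given by the
rigid motion `g`. -/
noncomputable def proj {N : ℕ} (g : EuclideanSpace ℝ (Fin N) ≃ᵢ EuclideanSpace ℝ (Fin N))
    (y : EuclideanSpace ℝ (Fin N)) : EuclideanSpace ℝ (Fin (N-1)) :=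
  (EuclideanSpace.equiv (Fin (N-1)) ℝ).symm (fun i => g y (Fin.castLE (Nat.sub_le N 1) i))

/-- `Ω` is a domain of class `C^{0,ω}` with parameter `r`, where `iN` is the index of the
last coordinate: around every boundary point, in a suitable Euclidean coordinate system,
`Ω` is the subgraph and `Γ` the graph of a function with modulus of continuity `ω`. -/
def IsC0omega {N : ℕ} (Ω : Set (EuclideanSpace ℝ (Fin N))) (ω : ℝ → ℝ) (r : ℝ)
    (iN : Fin N) : Prop :=
  0 < r ∧
  ∀ x ∈ frontier Ω, ∃ g : EuclideanSpace ℝ (Fin N) ≃ᵢ EuclideanSpace ℝ (Fin N),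
    ∃ φb : EuclideanSpace ℝ (Fin (N-1)) → ℝ,
      (∀ y ∈ Metric.ball x r, (y ∈ Ω ↔ g y iN < φb (proj g y))) ∧
      (∀ y ∈ Metric.ball x r, (y ∈ frontier Ω ↔ g y iN = φb (proj g y))) ∧
      (∀ y ∈ Metric.ball x r ∩ frontier Ω, ∀ z ∈ Metric.ball x r ∩ frontier Ω,
        |φb (proj g y) - φb (proj g z)| ≤ ω (dist (proj g y) (proj g z)))

/-! ### Test functions that are `C²` near the touching point -/

/-- A function that is `C²` at a point coincides near that point with a globally `C²` function. -/
theorem ContDiffAt.exists_contDiff_eventuallyEq {V : Type*} [NormedAddCommGroup V]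
    [NormedSpace ℝ V] [FiniteDimensional ℝ V] {φ : V → ℝ} {q : V} (h : ContDiffAt ℝ 2 φ q) :
    ∃ φ' : V → ℝ, ContDiff ℝ 2 φ' ∧ φ' =ᶠ[𝓝 q] φ := by
  have h2 : ∀ᶠ y in 𝓝 q, ContDiffAt ℝ 2 φ y := h.eventually (by decide)
  obtain ⟨δ, hδ, hball⟩ := Metric.eventually_nhds_iff_ball.mp h2
  let f : ContDiffBump q := ⟨δ / 4, δ / 2, by positivity, by linarith⟩
  refine ⟨fun y => f y * φ y, ?_, ?_⟩
  · rw [contDiff_iff_contDiffAt]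
    intro y
    by_cases hy : y ∈ ball q δ
    · exact f.contDiffAt.mul (hball y hy)
    · have hfar : y ∈ (closedBall q (δ / 2))ᶜ := by
        simp only [mem_ball, not_lt, mem_compl_iff, mem_closedBall, not_le] at hy ⊢
        linarith
      have hzero : (fun y => f y * φ y) =ᶠ[𝓝 y] fun _ => 0 := by
        filter_upwards [isClosed_closedBall.isOpen_compl.mem_nhds hfar] with z hz
        have : f z = 0 := f.zero_of_le_dist (by
          simp only [mem_compl_iff, mem_closedBall, not_le] at hz
          exact hz.le)
        simp [this]
      exact contDiffAt_const.congr_of_eventuallyEq hzero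
  · filter_upwards [f.eventuallyEq_one] with y hy
    simp [hy]

section Slices

variable {N : ℕ} {φ φ' : EuclideanSpace ℝ (Fin N) × ℝ → ℝ} {x : EuclideanSpace ℝ (Fin N)} {t : ℝ}

theorem deriv_slice_congr (h : φ' =ᶠ[𝓝 (x, t)] φ) :
    deriv (fun s => φ' (x, s)) t = deriv (fun s => φ (x, s)) t := by
  refine Filter.EventuallyEq.deriv_eq ?_
  have hc : Tendsto (fun s : ℝ => (x, s)) (𝓝 t) (𝓝 (x, t)) :=
    Continuous.tendsto (by fun_prop) t
  exact hc.eventually h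

theorem spatial_slice_congr (h : φ' =ᶠ[𝓝 (x, t)] φ) :
    (fun y => φ' (y, t)) =ᶠ[𝓝 x] fun y => φ (y, t) := by
  have hc : Tendsto (fun y : EuclideanSpace ℝ (Fin N) => (y, t)) (𝓝 x) (𝓝 (x, t)) :=
    Continuous.tendsto (by fun_prop) x
  exact hc.eventually h

theorem hess_congr {f f' : EuclideanSpace ℝ (Fin N) → ℝ} (h : f' =ᶠ[𝓝 x] f) :
    hess f' x = hess f x := by
  unfold hess
  rw [(h.iteratedFDeriv ℝ 2).eq_of_nhds]

end Slices

section Viscosity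

variable {N : ℕ} {p : ℝ} {Ω : Set (EuclideanSpace ℝ (Fin N))}
  {u : EuclideanSpace ℝ (Fin N) → ℝ → ℝ} {φ : EuclideanSpace ℝ (Fin N) × ℝ → ℝ}
  {x : EuclideanSpace ℝ (Fin N)} {t : ℝ}

/-- The subsolution inequality holds for test functions that are only `C²` at the touching
point. -/
theorem IsViscositySol.deriv_le_Fupper (hu : IsViscositySol p Ω u) (hx : x ∈ Ω) (ht : 0 < t)
    (hφ : ContDiffAt ℝ 2 φ (x, t))
    (hmax : IsLocalMaxOn (fun q : EuclideanSpace ℝ (Fin N) × ℝ => u q.1 q.2 - φ q)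
      (Ω ×ˢ Set.Ioi 0) (x, t)) :
    deriv (fun s => φ (x, s)) t ≤
      Fupper p (gradient (fun y => φ (y, t)) x) (hess (fun y => φ (y, t)) x) := by
  obtain ⟨φ', hφ', heq⟩ := hφ.exists_contDiff_eventuallyEq
  have hs := spatial_slice_congr heq
  rw [← deriv_slice_congr heq, ← hs.gradient_eq, ← hess_congr hs]
  refine hu.2.1 φ' hφ' x hx t ht ?_
  filter_upwards [hmax, nhdsWithin_le_nhds heq] with q hq hq'
  simpa only [hq', heq.eq_of_nhds] using hq

/-- The supersolution inequality holds for test functions that are only `C²` at the touching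
point. -/
theorem IsViscositySol.Flower_le_deriv (hu : IsViscositySol p Ω u) (hx : x ∈ Ω) (ht : 0 < t)
    (hφ : ContDiffAt ℝ 2 φ (x, t))
    (hmin : IsLocalMinOn (fun q : EuclideanSpace ℝ (Fin N) × ℝ => u q.1 q.2 - φ q)
      (Ω ×ˢ Set.Ioi 0) (x, t)) :
    Flower p (gradient (fun y => φ (y, t)) x) (hess (fun y => φ (y, t)) x) ≤
      deriv (fun s => φ (x, s)) t := by
  obtain ⟨φ', hφ', heq⟩ := hφ.exists_contDiff_eventuallyEq
  have hs := spatial_slice_congr heq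
  rw [← deriv_slice_congr heq, ← hs.gradient_eq, ← hess_congr hs]
  refine hu.2.2 φ' hφ' x hx t ht ?_
  filter_upwards [hmin, nhdsWithin_le_nhds heq] with q hq hq'
  simpa only [hq', heq.eq_of_nhds] using hq

end Viscosity

/-! ### The operator on radial functions -/

section Radial

variable {N : ℕ} {p : ℝ} {G G1 : ℝ → ℝ} {G2 : ℝ} {x z : EuclideanSpace ℝ (Fin N)}

theorem hasFDerivAt_radial {a : ℝ} (h : HasDerivAt G a (‖x - z‖ ^ 2)) :
    HasFDerivAt (fun y => G (‖y - z‖ ^ 2)) ((2 * a) • innerSL ℝ (x - z)) x := by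
  have h1 := ((hasFDerivAt_id (𝕜 := ℝ) x).sub_const z).norm_sq
  have h2 := h.comp_hasFDerivAt x h1
  refine h2.congr_fderiv ?_
  ext v
  simp
  ring

theorem gradient_radial {a : ℝ} (h : HasDerivAt G a (‖x - z‖ ^ 2)) :
    gradient (fun y => G (‖y - z‖ ^ 2)) x = (2 * a) • (x - z) := by
  refine HasGradientAt.gradient ?_
  rw [hasGradientAt_iff_hasFDerivAt]
  refine (hasFDerivAt_radial h).congr_fderiv ?_
  ext v
  simp

theorem hess_radial (h1 : ∀ᶠ s in 𝓝 (‖x - z‖ ^ 2), HasDerivAt G (G1 s) s)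
    (h2 : HasDerivAt G1 G2 (‖x - z‖ ^ 2)) (i j : Fin N) :
    hess (fun y => G (‖y - z‖ ^ 2)) x i j =
      (if i = j then 2 * G1 (‖x - z‖ ^ 2) else 0) + 4 * G2 * ((x - z) i * (x - z) j) := by
  have hcont : Tendsto (fun y : EuclideanSpace ℝ (Fin N) => ‖y - z‖ ^ 2) (𝓝 x)
      (𝓝 (‖x - z‖ ^ 2)) := Continuous.tendsto (by fun_prop) x
  have heq : fderiv ℝ (fun y => G (‖y - z‖ ^ 2)) =ᶠ[𝓝 x]
      fun y => (2 * G1 (‖y - z‖ ^ 2)) • innerSL ℝ (y - z) := by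
    filter_upwards [hcont.eventually h1] with y hy
    exact (hasFDerivAt_radial hy).fderiv
  have hc : HasFDerivAt (fun y => 2 * G1 (‖y - z‖ ^ 2))
      ((2 : ℝ) • ((2 * G2) • innerSL ℝ (x - z))) x := (hasFDerivAt_radial h2).const_mul 2
  have hL : HasFDerivAt (fun y : EuclideanSpace ℝ (Fin N) => innerSL ℝ (y - z))
      (innerSL ℝ : EuclideanSpace ℝ (Fin N) →L[ℝ] _) x :=
    ((innerSL ℝ : EuclideanSpace ℝ (Fin N) →L[ℝ] _).hasFDerivAt).comp x
      ((hasFDerivAt_id (𝕜 := ℝ) x).sub_const z)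
  have hprod := (hc.smul hL).congr_of_eventuallyEq heq
  unfold hess
  rw [iteratedFDeriv_two_apply, hprod.fderiv]
  change 2 * G1 (‖x - z‖ ^ 2) *
      inner ℝ (EuclideanSpace.single i (1 : ℝ)) (EuclideanSpace.single j (1 : ℝ)) +
    2 * (2 * G2 * inner ℝ (x - z) (EuclideanSpace.single i 1)) *
      inner ℝ (x - z) (EuclideanSpace.single j 1) = _
  by_cases hij : i = j
  · subst hij
    simp [EuclideanSpace.inner_single_right]
    ring
  · simp [EuclideanSpace.inner_single_right, hij]
    ring

theorem qform_radial {X : Matrix (Fin N) (Fin N) ℝ} {a b : ℝ} {w : EuclideanSpace ℝ (Fin N)}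
    (hX : ∀ i j, X i j = (if i = j then a else 0) + b * (w i * w j))
    (v : EuclideanSpace ℝ (Fin N)) :
    qform X v = a * ‖v‖ ^ 2 + b * (inner ℝ w v) ^ 2 := by
  have hin : inner ℝ w v = ∑ i, w i * v i := by
    simp [PiLp.inner_apply, mul_comm]
  unfold qform
  rw [hin, EuclideanSpace.real_norm_sq_eq, sq (∑ i, w i * v i), Finset.sum_mul_sum,
    Finset.mul_sum, Finset.mul_sum, ← Finset.sum_add_distrib]
  refine Finset.sum_congr rfl fun i _ => ?_
  simp only [hX, add_mul, ite_mul, zero_mul, Finset.sum_add_distrib, Finset.sum_ite_eq,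
    Finset.mem_univ, if_true, Finset.mul_sum]
  congr 1
  · ring
  · exact Finset.sum_congr rfl fun j _ => by ring

theorem trace_radial {X : Matrix (Fin N) (Fin N) ℝ} {a b : ℝ} {w : EuclideanSpace ℝ (Fin N)}
    (hX : ∀ i j, X i j = (if i = j then a else 0) + b * (w i * w j)) :
    X.trace = N * a + b * ‖w‖ ^ 2 := by
  rw [EuclideanSpace.real_norm_sq_eq, Matrix.trace, Finset.mul_sum]
  simp [hX, Finset.sum_add_distrib, sq]

theorem rayleigh_scalar (hN : 2 ≤ N) {X : Matrix (Fin N) (Fin N) ℝ} {a : ℝ}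
    (hX : ∀ v : EuclideanSpace ℝ (Fin N), qform X v = a * ‖v‖ ^ 2) :
    {r | ∃ v : EuclideanSpace ℝ (Fin N), ‖v‖ = 1 ∧ r = qform X v} = {a} := by
  ext r
  simp only [mem_ofPred_eq, mem_singleton_iff]
  constructor
  · rintro ⟨v, hv, rfl⟩
    simp [hX, hv]
  · rintro rfl
    refine ⟨EuclideanSpace.single ⟨0, by omega⟩ 1, by simp, by simp [hX]⟩

/-- On radial functions `y ↦ G(|y - z|²)` with `G' ≠ 0` both relaxations of the operator agree
and are given by an ordinary differential expression, also at the centre `z`. -/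
theorem Fupper_Flower_radial (hN : 2 ≤ N)
    (h1 : ∀ᶠ s in 𝓝 (‖x - z‖ ^ 2), HasDerivAt G (G1 s) s)
    (h2 : HasDerivAt G1 G2 (‖x - z‖ ^ 2)) (hne : G1 (‖x - z‖ ^ 2) ≠ 0) :
    Fupper p (gradient (fun y => G (‖y - z‖ ^ 2)) x) (hess (fun y => G (‖y - z‖ ^ 2)) x) =
      (1 / p) * (2 * (N + p - 2) * G1 (‖x - z‖ ^ 2) + 4 * (p - 1) * G2 * ‖x - z‖ ^ 2) ∧
    Flower p (gradient (fun y => G (‖y - z‖ ^ 2)) x) (hess (fun y => G (‖y - z‖ ^ 2)) x) =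
      (1 / p) * (2 * (N + p - 2) * G1 (‖x - z‖ ^ 2) + 4 * (p - 1) * G2 * ‖x - z‖ ^ 2) := by
  have hH := hess_radial h1 h2
  have hq := qform_radial hH
  have htr := trace_radial hH
  rw [gradient_radial h1.self_of_nhds]
  unfold Fupper Flower
  by_cases hxz : x - z = 0
  · have hray := rayleigh_scalar hN (a := 2 * G1 (‖x - z‖ ^ 2)) (fun v => by
      rw [hq v, hxz]; simp)
    have hmm : max (p - 2) 0 + min (p - 2) 0 = p - 2 := by
      rw [max_add_min]; ring
    have hmax : max (p - 2) 0 = p - 2 - min (p - 2) 0 := by linarith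
    rw [if_pos (by rw [hxz, smul_zero]), if_pos (by rw [hxz, smul_zero]), htr]
    unfold lamMin lamMax
    rw [hray, csInf_singleton, csSup_singleton, hmax, hxz]
    constructor <;> · simp only [norm_zero]; ring
  · have hsm : (2 * G1 (‖x - z‖ ^ 2)) • (x - z) ≠ 0 :=
      smul_ne_zero (mul_ne_zero two_ne_zero hne) hxz
    have hn : ‖x - z‖ ≠ 0 := norm_ne_zero_iff.mpr hxz
    rw [if_neg hsm, if_neg hsm]
    unfold Fop
    rw [htr, hq, norm_smul, inner_smul_right, real_inner_self_eq_norm_sq, mul_pow,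
      Real.norm_eq_abs, sq_abs]
    constructor <;> · field_simp; ring

end Radial

/-! ### Gaussian subsolutions and the lower bound -/

theorem gaussian_exponent_le {k b c Q t : ℝ} (hk : 0 < k) (hb : 0 < b)
    (ht : 0 < t) (hQ : 4 * (k * b) ≤ c * Q) {θ : ℝ} (hθ : 0 < θ) :
    k * (Real.log b - Real.log t) - c * Q / (4 * t) ≤
      k * b / (θ * t) + k * Real.log θ - k - k * b / t := by
  have h1 : Real.log (b / (θ * t)) ≤ b / (θ * t) - 1 :=
    Real.log_le_sub_one_of_pos (by positivity)
  rw [Real.log_div hb.ne' (by positivity), Real.log_mul hθ.ne' ht.ne'] at h1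
  have h2 : k * b / t ≤ c * Q / (4 * t) := by
    rw [div_le_div_iff₀ ht (by positivity)]
    nlinarith
  have h3 := mul_le_mul_of_nonneg_left h1 hk.le
  have h4 : k * (b / (θ * t) - 1) = k * b / (θ * t) - k := by ring
  linarith

theorem gaussian_exponent_nonpos {k b c Q t : ℝ} (hk : 0 < k) (hb : 0 < b)
    (ht : 0 < t) (hQ : 4 * (k * b) ≤ c * Q) :
    k * (Real.log b - Real.log t) - c * Q / (4 * t) ≤ 0 := by
  have h := gaussian_exponent_le hk hb ht hQ one_pos
  rw [Real.log_one, one_mul] at h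
  linarith

/-- Superlevel sets of the Gaussian exponent are bounded and stay away from `t = 0`. -/
theorem gaussian_exponent_coercive {k b c : ℝ} (hk : 0 < k) (hb : 0 < b) (hc : 0 < c) (L : ℝ) :
    ∃ t₁ : ℝ, 0 < t₁ ∧ ∃ t₂ R : ℝ, ∀ Q t : ℝ, 0 < t → 4 * (k * b) ≤ c * Q → 0 ≤ Q →
      L ≤ k * (Real.log b - Real.log t) - c * Q / (4 * t) → t₁ ≤ t ∧ t ≤ t₂ ∧ Q ≤ R := by
  set M := k * Real.log 2 - L with hM
  set t₂ := Real.exp (Real.log b - L / k) with ht₂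
  refine ⟨k * b / (2 * (|M| + 1)), by positivity, t₂,
    4 / c * (k * b / 2 + |M| * t₂), fun Q t ht hQ hQ0 hL => ?_⟩
  have hMa := le_abs_self M
  have hkb : 0 < k * b := by positivity
  have hhalf : k * b / t = 2 * (k * b / (2 * t)) := by field_simp
  have h1 := gaussian_exponent_le hk hb ht hQ two_pos
  have hlow : k * b / (2 * t) ≤ M := by linarith
  have hQt : 0 ≤ c * Q / (4 * t) := by positivity
  have htop : t ≤ t₂ := by
    rw [ht₂, ← Real.log_le_iff_le_exp ht]
    have h2 : L / k ≤ Real.log b - Real.log t := by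
      rw [div_le_iff₀ hk]; linarith
    linarith
  refine ⟨?_, htop, ?_⟩
  · rw [div_le_iff₀ (by positivity)] at hlow ⊢
    nlinarith
  · have h3 : Real.log (b / (2 * t)) ≤ b / (2 * t) - 1 :=
      Real.log_le_sub_one_of_pos (by positivity)
    rw [Real.log_div hb.ne' (by positivity), Real.log_mul two_ne_zero ht.ne'] at h3
    have h4 := mul_le_mul_of_nonneg_left h3 hk.le
    have h5 : k * (b / (2 * t) - 1) = k * b / (2 * t) - k := by ring
    have h6 : c * Q / (4 * t) ≤ k * b / (2 * t) + M := by linarith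
    have h7 : c * Q / 4 ≤ k * b / 2 + M * t := by
      have := mul_le_mul_of_nonneg_right h6 ht.le
      have e1 : c * Q / (4 * t) * t = c * Q / 4 := by field_simp
      have e2 : (k * b / (2 * t) + M) * t = k * b / 2 + M * t := by field_simp
      rwa [e1, e2] at this
    have h8 : M * t ≤ |M| * t₂ := by
      calc M * t ≤ |M| * t := by gcongr
        _ ≤ |M| * t₂ := by gcongr
    rw [div_mul_eq_mul_div, le_div_iff₀ hc]
    linarith

section LowerBound

variable {N : ℕ} {p : ℝ} {Ω : Set (EuclideanSpace ℝ (Fin N))}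
  {u : EuclideanSpace ℝ (Fin N) → ℝ → ℝ}

/-- A Gaussian with a sufficiently singular prefactor is a strict subsolution, so it cannot touch
a viscosity solution from below away from its centre. -/
theorem IsViscositySol.not_isLocalMinOn_gaussian (hN : 2 ≤ N) (hp : 1 < p)
    (hu : IsViscositySol p Ω u) {k b : ℝ} (hk : (N + p - 2) / (2 * (p - 1)) < k)
    {x z : EuclideanSpace ℝ (Fin N)} {t : ℝ} (hx : x ∈ Ω) (ht : 0 < t) :
    ¬ IsLocalMinOn (fun q : EuclideanSpace ℝ (Fin N) × ℝ => u q.1 q.2 -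
      Real.exp (k * (Real.log b - Real.log q.2) - p / (p - 1) * ‖q.1 - z‖ ^ 2 / (4 * q.2)))
      (Ω ×ˢ Set.Ioi 0) (x, t) := by
  intro hmin
  set c := p / (p - 1) with hc
  have hp1 : 0 < p - 1 := by linarith
  have hcpos : 0 < c := by positivity
  have hφ : ContDiffAt ℝ 2 (fun q : EuclideanSpace ℝ (Fin N) × ℝ =>
      Real.exp (k * (Real.log b - Real.log q.2) - c * ‖q.1 - z‖ ^ 2 / (4 * q.2))) (x, t) := by
    have hn : ContDiffAt ℝ 2 (fun q : EuclideanSpace ℝ (Fin N) × ℝ => ‖q.1 - z‖ ^ 2) (x, t) :=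
      (contDiffAt_fst.sub contDiffAt_const).norm_sq ℝ
    have hl : ContDiffAt ℝ 2 (fun q : EuclideanSpace ℝ (Fin N) × ℝ => Real.log q.2) (x, t) :=
      contDiffAt_snd.log ht.ne'
    exact ((contDiffAt_const.mul (contDiffAt_const.sub hl)).sub
      ((contDiffAt_const.mul hn).div (contDiffAt_const.mul contDiffAt_snd)
        (by simpa using ht.ne'))).exp
  have key := hu.Flower_le_deriv hx ht hφ hmin
  have h1 : ∀ s : ℝ, HasDerivAt
      (fun s => Real.exp (k * (Real.log b - Real.log t) - c * s / (4 * t)))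
      (-(c / (4 * t)) * Real.exp (k * (Real.log b - Real.log t) - c * s / (4 * t))) s := by
    intro s
    have h := ((((hasDerivAt_id s).const_mul c).div_const (4 * t)).const_sub
      (k * (Real.log b - Real.log t))).exp
    refine h.congr_deriv ?_
    rw [id_eq]
    ring
  have h2 : ∀ s : ℝ, HasDerivAt (fun s => -(c / (4 * t)) *
      Real.exp (k * (Real.log b - Real.log t) - c * s / (4 * t)))
      (-(c / (4 * t)) * (-(c / (4 * t)) *
        Real.exp (k * (Real.log b - Real.log t) - c * s / (4 * t)))) s :=
    fun s => (h1 s).const_mul _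
  have hF := (Fupper_Flower_radial (p := p) hN (Eventually.of_forall h1)
    (h2 (‖x - z‖ ^ 2)) (by
      have : 0 < c / (4 * t) := by positivity
      exact mul_ne_zero (by linarith) (Real.exp_ne_zero _))).2
  have hd : HasDerivAt (fun s => Real.exp (k * (Real.log b - Real.log s) -
      c * ‖x - z‖ ^ 2 / (4 * s)))
      (Real.exp (k * (Real.log b - Real.log t) - c * ‖x - z‖ ^ 2 / (4 * t)) *
        (k * (-(t⁻¹)) - c * ‖x - z‖ ^ 2 * (-4 / (4 * t) ^ 2))) t := by
    have hl := ((Real.hasDerivAt_log ht.ne').const_sub (Real.log b)).const_mul k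
    have hi : HasDerivAt (fun s : ℝ => c * ‖x - z‖ ^ 2 / (4 * s))
        (c * ‖x - z‖ ^ 2 * (-4 / (4 * t) ^ 2)) t := by
      have := (((hasDerivAt_id t).const_mul 4).inv (by simpa using ht.ne')).const_mul
        (c * ‖x - z‖ ^ 2)
      simpa [div_eq_mul_inv] using this
    exact (hl.sub hi).exp
  simp only at key hF
  rw [hF, hd.deriv] at key
  set V := Real.exp (k * (Real.log b - Real.log t) - c * ‖x - z‖ ^ 2 / (4 * t))
  have hV : 0 < V := Real.exp_pos _
  have hdiff : V * (k * (-(t⁻¹)) - c * ‖x - z‖ ^ 2 * (-4 / (4 * t) ^ 2)) -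
      1 / p * (2 * (N + p - 2) * (-(c / (4 * t)) * V) +
        4 * (p - 1) * (-(c / (4 * t)) * (-(c / (4 * t)) * V)) * ‖x - z‖ ^ 2) =
      V / t * ((N + p - 2) / (2 * (p - 1)) - k) := by
    rw [hc]
    field_simp
    ring
  have : V / t * ((N + p - 2) / (2 * (p - 1)) - k) < 0 :=
    mul_neg_of_pos_of_neg (by positivity) (by linarith)
  linarith

/-- If a ball of radius `ρ` around `z` misses `Ω̄`, then `u` dominates the corresponding
Gaussian. -/
theorem IsSolP.gaussian_le (hN : 2 ≤ N) (hp : 1 < p) (hu : IsSolP p Ω u)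
    (hΩo : IsOpen Ω) (hupos : ∀ x ∈ Ω, ∀ t : ℝ, 0 < t → 0 < u x t)
    {k ρ : ℝ} (hk : (N + p - 2) / (2 * (p - 1)) < k) (hρ : 0 < ρ)
    {z : EuclideanSpace ℝ (Fin N)} (hz : ∀ w ∈ closure Ω, ρ ≤ ‖w - z‖)
    {x : EuclideanSpace ℝ (Fin N)} (hx : x ∈ closure Ω) {t : ℝ} (ht : 0 < t) :
    Real.exp (k * (Real.log (p / (p - 1) * ρ ^ 2 / (4 * k)) - Real.log t) -
      p / (p - 1) * ‖x - z‖ ^ 2 / (4 * t)) ≤ u x t := by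
  have hp1 : 0 < p - 1 := by linarith
  have hN' : (2 : ℝ) ≤ N := by exact_mod_cast hN
  have hk0 : 0 < k := lt_of_le_of_lt (div_nonneg (by linarith) (by linarith)) hk
  set c := p / (p - 1) with hc
  have hcpos : 0 < c := by positivity
  set b := c * ρ ^ 2 / (4 * k) with hb
  have hbpos : 0 < b := by positivity
  have hfr : ∀ w ∈ closure Ω, w ∉ Ω → w ∈ frontier Ω := fun w hw hw' => by
    rw [hΩo.frontier_eq]; exact ⟨hw, hw'⟩
  have hu0 : ∀ y ∈ closure Ω, ∀ s : ℝ, 0 < s → 0 < u y s := fun y hy s hs => by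
    by_cases hyΩ : y ∈ Ω
    · exact hupos y hyΩ s hs
    · rw [hu.2.2.2.2 y (hfr y hy hyΩ) s hs]; exact one_pos
  have hQ : ∀ w ∈ closure Ω, 4 * (k * b) ≤ c * ‖w - z‖ ^ 2 := fun w hw => by
    have h1 : 4 * (k * b) = c * ρ ^ 2 := by rw [hb]; field_simp
    rw [h1]
    have := hz w hw
    gcongr
  set v : EuclideanSpace ℝ (Fin N) × ℝ → ℝ := fun q =>
    Real.exp (k * (Real.log b - Real.log q.2) - c * ‖q.1 - z‖ ^ 2 / (4 * q.2)) with hv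
  change v (x, t) ≤ u x t
  by_contra! hlt
  set ε := v (x, t) - u x t with hε
  have hεpos : 0 < ε := sub_pos.mpr hlt
  obtain ⟨t₁, ht₁, t₂, R, hcoer⟩ :=
    gaussian_exponent_coercive hk0 hbpos hcpos (Real.log ε)
  set S : Set (EuclideanSpace ℝ (Fin N) × ℝ) :=
    (closure Ω ∩ closedBall z (R + 1)) ×ˢ Set.Icc t₁ t₂ with hS
  have hmem : ∀ y ∈ closure Ω, ∀ s : ℝ, 0 < s → ε ≤ v (y, s) → (y, s) ∈ S := by
    intro y hy s hs hle
    have hL := (Real.log_le_iff_le_exp hεpos).mpr hle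
    obtain ⟨h1, h2, h3⟩ := hcoer (‖y - z‖ ^ 2) s hs (hQ y hy) (by positivity) hL
    refine ⟨⟨hy, ?_⟩, h1, h2⟩
    rw [mem_closedBall, dist_eq_norm]
    nlinarith [sq_nonneg (‖y - z‖ - 1)]
  have hScomp : IsCompact S :=
    ((isCompact_closedBall z (R + 1)).inter_left isClosed_closure).prod isCompact_Icc
  have hxS : (x, t) ∈ S := hmem x hx t ht (by linarith [hu0 x hx t ht])
  have hcont : ContinuousOn (fun q : EuclideanSpace ℝ (Fin N) × ℝ => v q - u q.1 q.2) S := by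
    refine ContinuousOn.sub ?_ ?_
    · intro q hq
      have hq2 : q.2 ≠ 0 := (lt_of_lt_of_le ht₁ hq.2.1).ne'
      refine ContinuousAt.continuousWithinAt ?_
      have : ContinuousAt (fun q : EuclideanSpace ℝ (Fin N) × ℝ => Real.log q.2) q :=
        continuousAt_snd.log hq2
      have h4 : (4 * q.2) ≠ 0 := by positivity
      fun_prop (disch := assumption)
    · rintro ⟨y, s⟩ ⟨⟨hy, -⟩, hs⟩
      have hs0 : 0 < s := lt_of_lt_of_le ht₁ hs.1
      refine (hu.2.1 y hy s hs0.le fun h => hs0.ne' h.2).mono ?_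
      rintro ⟨y', s'⟩ ⟨⟨hy', -⟩, hs'⟩
      exact ⟨hy', (lt_of_lt_of_le ht₁ hs'.1).le⟩
  obtain ⟨⟨y, s⟩, hyS, hmax⟩ := hScomp.exists_isMaxOn ⟨_, hxS⟩ hcont
  have hy : y ∈ closure Ω := hyS.1.1
  have hs : 0 < s := lt_of_lt_of_le ht₁ hyS.2.1
  have hval : ε ≤ v (y, s) - u y s := hmax hxS
  have hyΩ : y ∈ Ω := by
    by_contra hn
    have hu1 := hu.2.2.2.2 y (hfr y hy hn) s hs
    have hv1 : v (y, s) ≤ 1 :=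
      Real.exp_le_one_iff.mpr (gaussian_exponent_nonpos hk0 hbpos hs (hQ y hy))
    linarith
  refine IsViscositySol.not_isLocalMinOn_gaussian (b := b) (z := z) hN hp hu.2.2.1 hk hyΩ hs ?_
  refine IsMinOn.localize ?_
  rintro ⟨y', s'⟩ ⟨hy', hs'⟩
  have hyc : y' ∈ closure Ω := subset_closure hy'
  have hle : v (y', s') - u y' s' ≤ v (y, s) - u y s := by
    by_cases hε' : ε ≤ v (y', s')
    · exact hmax (hmem y' hyc s' hs' hε')
    · have := hu0 y' hyc s' hs'
      linarith
  change u y s - v (y, s) ≤ u y' s' - v (y', s')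
  linarith

end LowerBound

/-! ### Exponential supersolutions and the upper bound -/

theorem radial_profile_lt {μ q : ℝ} (hμ : 1 < μ) (hq : μ + 1 ≤ q) :
    μ * (1 / q - μ / q ^ 2) + (q ^ 2 - (μ + 1) ^ 2) *
      ((1 / q - μ / q ^ 2) ^ 2 + (-1 / q ^ 2 + 2 * μ / q ^ 3) / q) < 1 := by
  have hq0 : 0 < q := by linarith
  have key : 1 - (μ * (1 / q - μ / q ^ 2) + (q ^ 2 - (μ + 1) ^ 2) *
      ((1 / q - μ / q ^ 2) ^ 2 + (-1 / q ^ 2 + 2 * μ / q ^ 3) / q)) =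
      (q * ((μ + 1) * q ^ 2 - 2 * μ * q - (μ + 1) ^ 2) +
        (μ + 1) ^ 2 * ((q - μ) ^ 2 + 2 * μ)) / q ^ 4 := by
    field_simp
    ring
  have h1 : 0 ≤ (μ + 1) * q ^ 2 - 2 * μ * q - (μ + 1) ^ 2 := by
    have h3 : μ + 1 ≤ (μ + 1) * q - 2 * μ := by nlinarith
    have h4 : (μ + 1) * (μ + 1) ≤ q * ((μ + 1) * q - 2 * μ) :=
      mul_le_mul hq h3 (by linarith) hq0.le
    linarith
  have h2 : 0 < (q * ((μ + 1) * q ^ 2 - 2 * μ * q - (μ + 1) ^ 2) +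
      (μ + 1) ^ 2 * ((q - μ) ^ 2 + 2 * μ)) / q ^ 4 := by
    have : 0 < (μ + 1) ^ 2 * ((q - μ) ^ 2 + 2 * μ) := by positivity
    have := mul_nonneg hq0.le h1
    positivity
  linarith

section UpperBound

variable {N : ℕ} {p : ℝ} {Ω : Set (EuclideanSpace ℝ (Fin N))}
  {u : EuclideanSpace ℝ (Fin N) → ℝ → ℝ}

/-- The function `exp (λt + γ + q - μ log q)`, `q = √((μ+1)² + a²|x - z|²)`, is a strict
supersolution, so it cannot touch a viscosity solution from above. -/
theorem IsViscositySol.not_isLocalMaxOn_exponential (hN : 2 ≤ N) (hp : 1 < p)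
    (hu : IsViscositySol p Ω u) {μ a γ : ℝ} (hμ : μ = (N + p - 2) / (p - 1)) (ha : 0 < a)
    {x z : EuclideanSpace ℝ (Fin N)} {t : ℝ} (hx : x ∈ Ω) (ht : 0 < t) :
    ¬ IsLocalMaxOn (fun q : EuclideanSpace ℝ (Fin N) × ℝ => u q.1 q.2 -
      Real.exp (a ^ 2 * (p - 1) / p * q.2 + γ +
        (Real.sqrt ((μ + 1) ^ 2 + a ^ 2 * ‖q.1 - z‖ ^ 2) -
          μ * Real.log (Real.sqrt ((μ + 1) ^ 2 + a ^ 2 * ‖q.1 - z‖ ^ 2)))))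
      (Ω ×ˢ Set.Ioi 0) (x, t) := by
  intro hmax
  have hp1 : 0 < p - 1 := by linarith
  have hN' : (2 : ℝ) ≤ N := by exact_mod_cast hN
  have hμ1 : 1 < μ := by
    rw [hμ, lt_div_iff₀ hp1]; linarith
  have hHpos : ∀ s : ℝ, 0 ≤ s → 0 < (μ + 1) ^ 2 + a ^ 2 * s := fun s hs => by positivity
  set l := a ^ 2 * (p - 1) / p with hl
  have hφ : ContDiffAt ℝ 2 (fun q : EuclideanSpace ℝ (Fin N) × ℝ =>
      Real.exp (l * q.2 + γ + (Real.sqrt ((μ + 1) ^ 2 + a ^ 2 * ‖q.1 - z‖ ^ 2) -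
          μ * Real.log (Real.sqrt ((μ + 1) ^ 2 + a ^ 2 * ‖q.1 - z‖ ^ 2))))) (x, t) := by
    have hn : ContDiffAt ℝ 2 (fun q : EuclideanSpace ℝ (Fin N) × ℝ => ‖q.1 - z‖ ^ 2) (x, t) :=
      (contDiffAt_fst.sub contDiffAt_const).norm_sq ℝ
    have hH0 := hHpos (‖x - z‖ ^ 2) (by positivity)
    have hs : ContDiffAt ℝ 2 (fun q : EuclideanSpace ℝ (Fin N) × ℝ =>
        Real.sqrt ((μ + 1) ^ 2 + a ^ 2 * ‖q.1 - z‖ ^ 2)) (x, t) :=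
      (contDiffAt_const.add (contDiffAt_const.mul hn)).sqrt hH0.ne'
    exact (((contDiffAt_const.mul contDiffAt_snd).add contDiffAt_const).add
      (hs.sub (contDiffAt_const.mul (hs.log (Real.sqrt_ne_zero'.mpr hH0))))).exp
  have key := hu.deriv_le_Fupper hx ht hφ hmax
  set r : ℝ → ℝ := fun s => Real.sqrt ((μ + 1) ^ 2 + a ^ 2 * s) with hr
  set G : ℝ → ℝ := fun s => Real.exp (l * t + γ + (r s - μ * Real.log (r s))) with hG
  have hrpos : ∀ s : ℝ, 0 < (μ + 1) ^ 2 + a ^ 2 * s → 0 < r s := fun s hs => Real.sqrt_pos.mpr hs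
  have hrd : ∀ s : ℝ, 0 < (μ + 1) ^ 2 + a ^ 2 * s → HasDerivAt r (a ^ 2 / (2 * r s)) s := by
    intro s hs
    have h := (((hasDerivAt_id s).const_mul (a ^ 2)).const_add ((μ + 1) ^ 2)).sqrt hs.ne'
    refine h.congr_deriv ?_
    rw [mul_one]
    rfl
  have h1 : ∀ s : ℝ, 0 < (μ + 1) ^ 2 + a ^ 2 * s → HasDerivAt G
      (G s * (a ^ 2 / 2 * (1 / r s - μ / r s ^ 2))) s := by
    intro s hs
    have hrs := hrpos s hs
    have h := (((hrd s hs).sub (((hrd s hs).log hrs.ne').const_mul μ)).const_add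
      (l * t + γ)).exp
    refine h.congr_deriv ?_
    simp only [hG, Pi.sub_apply]
    field_simp
  have h2 : ∀ s : ℝ, 0 < (μ + 1) ^ 2 + a ^ 2 * s → HasDerivAt
      (fun s => G s * (a ^ 2 / 2 * (1 / r s - μ / r s ^ 2)))
      (G s * (a ^ 4 / 4 * ((1 / r s - μ / r s ^ 2) ^ 2 +
        (-1 / r s ^ 2 + 2 * μ / r s ^ 3) / r s))) s := by
    intro s hs
    have hrs := hrpos s hs
    have hinv := (hasDerivAt_const s (1 : ℝ)).div (hrd s hs) hrs.ne'
    have hinv2 := (hasDerivAt_const s μ).div ((hrd s hs).pow 2) (pow_pos hrs 2).ne'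
    have h := (h1 s hs).mul ((hinv.sub hinv2).const_mul (a ^ 2 / 2))
    refine h.congr_deriv ?_
    simp only [Pi.div_apply, Pi.pow_apply, Pi.sub_apply]
    field_simp
    ring
  set Q := ‖x - z‖ ^ 2 with hQ
  have hQ0 : 0 ≤ Q := by positivity
  have hHQ := hHpos Q hQ0
  have hev : ∀ᶠ s in 𝓝 Q, HasDerivAt G (G s * (a ^ 2 / 2 * (1 / r s - μ / r s ^ 2))) s := by
    have hc : Continuous fun s : ℝ => (μ + 1) ^ 2 + a ^ 2 * s := by fun_prop
    filter_upwards [hc.continuousAt.eventually (lt_mem_nhds hHQ)] with s hs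
    exact h1 s hs
  have hrQ : 0 < r Q := hrpos Q hHQ
  have hrsq : r Q ^ 2 = (μ + 1) ^ 2 + a ^ 2 * Q := Real.sq_sqrt hHQ.le
  have hrge : μ + 1 ≤ r Q := by
    refine Real.le_sqrt_of_sq_le ?_
    have : 0 ≤ a ^ 2 * Q := by positivity
    linarith
  have hGQ : 0 < G Q := Real.exp_pos _
  have hF := (Fupper_Flower_radial (p := p) hN hev (h2 Q hHQ) (by
    have e : 1 / r Q - μ / r Q ^ 2 = (r Q - μ) / r Q ^ 2 := by field_simp
    have : 0 < r Q - μ := by linarith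
    rw [e]
    positivity)).1
  have hd : HasDerivAt (fun s => Real.exp (l * s + γ + (r Q - μ * Real.log (r Q))))
      (G Q * l) t := by
    have h := ((((hasDerivAt_id t).const_mul l).add_const γ).add_const
      (r Q - μ * Real.log (r Q))).exp
    refine h.congr_deriv ?_
    rw [mul_one]
    rfl
  have key' : G Q * l ≤ 1 / p * (2 * (N + p - 2) *
      (G Q * (a ^ 2 / 2 * (1 / r Q - μ / r Q ^ 2))) + 4 * (p - 1) *
      (G Q * (a ^ 4 / 4 * ((1 / r Q - μ / r Q ^ 2) ^ 2 +
        (-1 / r Q ^ 2 + 2 * μ / r Q ^ 3) / r Q))) * Q) := by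
    rw [← hd.deriv, ← hF]
    exact key
  have hNp : (N : ℝ) + p - 2 = μ * (p - 1) := by rw [hμ]; field_simp
  have hprof := radial_profile_lt hμ1 hrge
  have haQ : r Q ^ 2 - (μ + 1) ^ 2 = a ^ 2 * Q := by linarith
  rw [haQ] at hprof
  set P1 := 1 / r Q - μ / r Q ^ 2
  set P2 := P1 ^ 2 + (-1 / r Q ^ 2 + 2 * μ / r Q ^ 3) / r Q
  have e : 1 / p * (2 * (N + p - 2) * (G Q * (a ^ 2 / 2 * P1)) +
      4 * (p - 1) * (G Q * (a ^ 4 / 4 * P2)) * Q) =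
      G Q * l * (μ * P1 + a ^ 2 * Q * P2) := by
    rw [hNp, hl]
    ring
  have hlpos : 0 < l := by positivity
  have : G Q * l * (μ * P1 + a ^ 2 * Q * P2) < G Q * l * 1 :=
    mul_lt_mul_of_pos_left hprof (by positivity)
  linarith

/-- Comparison with the exponential supersolution in a ball compactly contained in `Ω`. -/
theorem IsSolP.le_exponential (hN : 2 ≤ N) (hp : 1 < p) (hu : IsSolP p Ω u)
    (hΩo : IsOpen Ω) (hulo : ∀ x ∈ Ω, ∀ t : ℝ, 0 < t → u x t < 1)
    {μ a d : ℝ} (hμ : μ = (N + p - 2) / (p - 1)) (ha : 0 < a) (hd : 0 ≤ d)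
    {x : EuclideanSpace ℝ (Fin N)} (hball : closedBall x d ⊆ Ω) {t : ℝ} (ht : 0 < t) :
    u x t ≤ Real.exp (a ^ 2 * (p - 1) / p * t +
      -(Real.sqrt ((μ + 1) ^ 2 + a ^ 2 * d ^ 2) -
          μ * Real.log (Real.sqrt ((μ + 1) ^ 2 + a ^ 2 * d ^ 2))) +
      (μ + 1 - μ * Real.log (μ + 1))) := by
  have hp1 : 0 < p - 1 := by linarith
  have hN' : (2 : ℝ) ≤ N := by exact_mod_cast hN
  have hμ0 : 0 < μ := by
    rw [hμ]; exact div_pos (by linarith) hp1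
  set γ := -(Real.sqrt ((μ + 1) ^ 2 + a ^ 2 * d ^ 2) -
          μ * Real.log (Real.sqrt ((μ + 1) ^ 2 + a ^ 2 * d ^ 2))) with hγ
  set l := a ^ 2 * (p - 1) / p with hl
  have hlpos : 0 < l := by positivity
  set w : EuclideanSpace ℝ (Fin N) × ℝ → ℝ := fun q => Real.exp (l * q.2 + γ +
    (Real.sqrt ((μ + 1) ^ 2 + a ^ 2 * ‖q.1 - x‖ ^ 2) -
      μ * Real.log (Real.sqrt ((μ + 1) ^ 2 + a ^ 2 * ‖q.1 - x‖ ^ 2)))) with hw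
  have hsqrt : ∀ y : EuclideanSpace ℝ (Fin N),
      0 < Real.sqrt ((μ + 1) ^ 2 + a ^ 2 * ‖y - x‖ ^ 2) :=
    fun y => Real.sqrt_pos.mpr (by positivity)
  have hwx : w (x, t) = Real.exp (l * t + γ + (μ + 1 - μ * Real.log (μ + 1))) := by
    have : Real.sqrt ((μ + 1) ^ 2) = μ + 1 := Real.sqrt_sq (by linarith)
    simp [hw, this]
  rw [← hwx]
  by_contra! hlt
  set κ := μ - μ * Real.log μ with hκ
  have hκle : ∀ q : ℝ, 0 < q → κ ≤ q - μ * Real.log q := by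
    intro q hq
    have h1 : Real.log (q / μ) ≤ q / μ - 1 := Real.log_le_sub_one_of_pos (by positivity)
    rw [Real.log_div hq.ne' hμ0.ne'] at h1
    have h2 := mul_le_mul_of_nonneg_left h1 hμ0.le
    have h3 : μ * (q / μ - 1) = q - μ := by field_simp
    linarith
  set T := (|γ| + |κ|) / l with hT
  have hTlarge : ∀ y : EuclideanSpace ℝ (Fin N), ∀ s : ℝ, T ≤ s → 1 ≤ w (y, s) := by
    intro y s hs
    refine Real.one_le_exp ?_
    rw [hT, div_le_iff₀ hlpos] at hs
    have h1 := hκle _ (hsqrt y)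
    have h2 := neg_abs_le γ
    have h3 := neg_abs_le κ
    linarith
  have hcb : x ∈ closedBall x d := mem_closedBall_self hd
  have htT : t < T := by
    by_contra! h
    have h1 := hTlarge x t h
    have h2 := hulo x (hball hcb) t ht
    linarith
  set S : Set (EuclideanSpace ℝ (Fin N) × ℝ) := closedBall x d ×ˢ Set.Icc 0 T with hS
  have hScomp : IsCompact S := (isCompact_closedBall x d).prod isCompact_Icc
  have hxS : (x, t) ∈ S := ⟨hcb, ht.le, htT.le⟩
  have hcont : ContinuousOn (fun q : EuclideanSpace ℝ (Fin N) × ℝ => u q.1 q.2 - w q) S := by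
    refine ContinuousOn.sub ?_ ?_
    · rintro ⟨y, s⟩ ⟨hy, hs⟩
      have hyΩ := hball hy
      refine (hu.2.1 y (subset_closure hyΩ) s hs.1 fun h => ?_).mono ?_
      · rw [hΩo.frontier_eq] at h
        exact h.1.2 hyΩ
      · rintro ⟨y', s'⟩ ⟨hy', hs'⟩
        exact ⟨subset_closure (hball hy'), hs'.1⟩
    · refine Continuous.continuousOn ?_
      have hlog : Continuous fun q : EuclideanSpace ℝ (Fin N) × ℝ =>
          Real.log (Real.sqrt ((μ + 1) ^ 2 + a ^ 2 * ‖q.1 - x‖ ^ 2)) :=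
        Continuous.log (by fun_prop) fun q => (hsqrt q.1).ne'
      fun_prop
  obtain ⟨⟨y, s⟩, hyS, hmax⟩ := hScomp.exists_isMaxOn ⟨_, hxS⟩ hcont
  have hval : 0 < u y s - w (y, s) := lt_of_lt_of_le (sub_pos.mpr hlt) (hmax hxS)
  have hyΩ : y ∈ Ω := hball hyS.1
  have hs : 0 < s := by
    refine lt_of_le_of_ne hyS.2.1 fun h => ?_
    have h1 := hu.2.2.2.1 y hyΩ
    have h2 : 0 < w (y, s) := Real.exp_pos _
    rw [← h] at hval h2
    linarith
  have hu1 := hulo y hyΩ s hs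
  have hsT : s < T := by
    by_contra! h
    have h1 := hTlarge y s h
    linarith
  have hyd : y ∈ ball x d := by
    refine lt_of_le_of_ne (mem_closedBall.mp hyS.1) fun h => ?_
    have h1 : 1 ≤ w (y, s) := by
      refine Real.one_le_exp ?_
      simp only
      rw [← dist_eq_norm, h, hγ]
      have : 0 < l * s := by positivity
      linarith
    linarith
  refine IsViscositySol.not_isLocalMaxOn_exponential (γ := γ) (z := x) hN hp hu.2.2.1 hμ ha
    hyΩ hs ?_
  have hnhds : ball x d ×ˢ Set.Ioo 0 T ∈ 𝓝 (y, s) :=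
    (isOpen_ball.prod isOpen_Ioo).mem_nhds ⟨hyd, hs, hsT⟩
  filter_upwards [nhdsWithin_le_nhds hnhds] with q hq
  exact hmax (show q ∈ S from ⟨ball_subset_closedBall hq.1, hq.2.1.le, hq.2.2.le⟩)

end UpperBound

/-! ### Exterior balls for domains of class `C^{0,ω}` -/

section Exterior

variable {N : ℕ} {Ω : Set (EuclideanSpace ℝ (Fin N))} {ω ψ : ℝ → ℝ} {r : ℝ}

theorem dist_proj_sq_add (g : EuclideanSpace ℝ (Fin N) ≃ᵢ EuclideanSpace ℝ (Fin N)) {iN : Fin N}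
    (hiN : (iN : ℕ) = N - 1) (a b : EuclideanSpace ℝ (Fin N)) :
    dist a b ^ 2 = dist (proj g a) (proj g b) ^ 2 + (g a iN - g b iN) ^ 2 := by
  obtain ⟨M, rfl⟩ : ∃ M, N = M + 1 := ⟨N - 1, by have := iN.isLt; omega⟩
  have hlast : iN = Fin.last M := Fin.ext (by simpa using hiN)
  rw [← g.dist_eq a b, EuclideanSpace.dist_eq, EuclideanSpace.dist_eq,
    Real.sq_sqrt (by positivity), Real.sq_sqrt (by positivity), Fin.sum_univ_castSucc, hlast]
  simp only [Real.dist_eq, sq_abs]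
  rfl

theorem continuousOn_modulus (hω0 : ω 0 = 0) (hωcont : ContinuousOn ω (Set.Ioi 0))
    (hωlim : Tendsto ω (𝓝[>] (0 : ℝ)) (𝓝 0)) : ContinuousOn ω (Set.Ici 0) := by
  intro s hs
  rcases eq_or_lt_of_le (mem_Ici.mp hs) with rfl | h
  · have h1 : ContinuousWithinAt ω (Set.Ioi 0) 0 := by
      rw [ContinuousWithinAt, hω0]; exact hωlim
    rw [← Set.Ioi_insert]
    exact h1.insert
  · exact (hωcont.continuousAt (Ioi_mem_nhds h)).continuousWithinAt

theorem psi_le (hψ : ∀ t : ℝ, ψ t = sInf ((fun s => Real.sqrt (s^2 + (t - ω s)^2)) '' Set.Icc 0 r))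
    (t : ℝ) {s : ℝ} (hs : s ∈ Set.Icc 0 r) : ψ t ≤ Real.sqrt (s ^ 2 + (t - ω s) ^ 2) := by
  rw [hψ]
  refine csInf_le ⟨0, ?_⟩ ⟨s, hs, rfl⟩
  rintro _ ⟨s, -, rfl⟩
  exact Real.sqrt_nonneg _

theorem psi_le_self
    (hψ : ∀ t : ℝ, ψ t = sInf ((fun s => Real.sqrt (s^2 + (t - ω s)^2)) '' Set.Icc 0 r))
    (hω0 : ω 0 = 0) (hr : 0 < r) {t : ℝ} (ht : 0 < t) : ψ t ≤ t := by
  have h := psi_le hψ t (left_mem_Icc.mpr hr.le)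
  rwa [hω0, sub_zero, zero_pow two_ne_zero, zero_add, Real.sqrt_sq ht.le] at h

theorem psi_pos (hψ : ∀ t : ℝ, ψ t = sInf ((fun s => Real.sqrt (s^2 + (t - ω s)^2)) '' Set.Icc 0 r))
    (hω0 : ω 0 = 0) (hωc : ContinuousOn ω (Set.Ici 0)) (hr : 0 < r) {t : ℝ} (ht : 0 < t) :
    0 < ψ t := by
  have hc : ContinuousOn (fun s => Real.sqrt (s^2 + (t - ω s)^2)) (Set.Icc 0 r) := by
    have : ContinuousOn ω (Set.Icc 0 r) := hωc.mono Icc_subset_Ici_self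
    fun_prop
  obtain ⟨s, hs, hs'⟩ := (isCompact_Icc.image_of_continuousOn hc).sInf_mem
    ((nonempty_Icc.mpr hr.le).image _)
  rw [hψ, ← hs']
  refine Real.sqrt_pos.mpr ?_
  rcases eq_or_lt_of_le hs.1 with rfl | h
  · rw [hω0]; positivity
  · positivity

/-- Every boundary point of a `C^{0,ω}` domain has at distance `τ` the centre of a ball of radius
`ψ(τ)` that misses `Ω̄`. -/
theorem IsC0omega.exists_exterior_ball {iN : Fin N} (hiN : (iN : ℕ) = N - 1)
    (hΩo : IsOpen Ω) (hreg : IsC0omega Ω ω r iN)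
    (hψ : ∀ t : ℝ, ψ t = sInf ((fun s => Real.sqrt (s^2 + (t - ω s)^2)) '' Set.Icc 0 r))
    (hω0 : ω 0 = 0) (hωc : ContinuousOn ω (Set.Ici 0))
    {y : EuclideanSpace ℝ (Fin N)} (hy : y ∈ frontier Ω) {τ : ℝ} (hτ : 0 < τ) (hτr : 2 * τ ≤ r) :
    ∃ z : EuclideanSpace ℝ (Fin N), dist z y = τ ∧ ∀ w ∈ closure Ω, ψ τ ≤ ‖w - z‖ := by
  obtain ⟨hr, hreg⟩ := hreg
  obtain ⟨g, φb, hΩ, hfr, hmod⟩ := hreg y hy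
  set z := g.symm (g y + τ • EuclideanSpace.single iN (1 : ℝ)) with hz
  have hgz : g z = g y + τ • EuclideanSpace.single iN (1 : ℝ) := by simp [hz]
  have hzy : dist z y = τ := by
    rw [← g.dist_eq, hgz, dist_eq_norm, add_sub_cancel_left, norm_smul]
    simp [abs_of_pos hτ]
  have hzN : g z iN = g y iN + τ := by simp [hgz]
  have hzp : proj g z = proj g y := by
    ext i
    change g z (Fin.castLE _ i) = g y (Fin.castLE _ i)
    have hne : Fin.castLE (Nat.sub_le N 1) i ≠ iN := by
      intro h
      have h1 := congrArg Fin.val h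
      simp only [Fin.val_castLE] at h1
      have := i.isLt
      omega
    simp [hgz, hne]
  have hyN : g y iN = φb (proj g y) := (hfr y (mem_ball_self hr)).mp hy
  have hzball : z ∈ ball y r := by rw [mem_ball, hzy]; linarith
  have hzΩ : z ∉ Ω := by
    rw [hΩ z hzball, hzN, hzp, hyN]; linarith
  have hbd : ∀ w ∈ frontier Ω, w ∈ ball y r → ψ τ ≤ dist w z := by
    intro w hw hwr
    set s := dist (proj g w) (proj g y) with hs
    have hs0 : 0 ≤ s := dist_nonneg
    have hwN : g w iN = φb (proj g w) := (hfr w hwr).mp hw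
    have hδ := hmod w ⟨hwr, hw⟩ y ⟨mem_ball_self hr, hy⟩
    rw [← hwN, ← hyN] at hδ
    have hδ' := (abs_le.mp hδ).2
    have hd := dist_proj_sq_add g hiN w z
    rw [hzp, hzN] at hd
    have hdy := dist_proj_sq_add g hiN w y
    have hsr : s ≤ r := by
      have h1 : s ≤ dist w y := by
        refine abs_le_of_sq_le_sq' ?_ dist_nonneg |>.2
        rw [hdy]
        nlinarith [sq_nonneg (g w iN - g y iN)]
      exact h1.trans (mem_ball.mp hwr).le
    rcases le_or_gt (ω s) τ with h | h
    · refine (psi_le hψ τ ⟨hs0, hsr⟩).trans (Real.sqrt_le_iff.mpr ⟨dist_nonneg, ?_⟩)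
      rw [hd]
      nlinarith
    · obtain ⟨s', hs', hωs'⟩ : τ ∈ ω '' Set.Icc 0 s :=
        intermediate_value_Icc hs0 (hωc.mono Icc_subset_Ici_self) ⟨by rw [hω0]; exact hτ.le, h.le⟩
      have h1 := psi_le hψ τ (s := s') ⟨hs'.1, hs'.2.trans hsr⟩
      rw [hωs', sub_self, zero_pow two_ne_zero, add_zero, Real.sqrt_sq hs'.1] at h1
      refine (h1.trans hs'.2).trans (abs_le_of_sq_le_sq' ?_ dist_nonneg).2
      rw [hd]
      nlinarith [sq_nonneg (g w iN - (g y iN + τ))]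
  refine ⟨z, hzy, fun w hw => ?_⟩
  by_contra! hlt
  rw [← dist_eq_norm] at hlt
  have hψτ := psi_le_self hψ hω0 hr hτ
  have hψ0 : 0 < ψ τ := lt_of_le_of_lt dist_nonneg hlt
  have hpre : IsPreconnected (ball z (ψ τ)) := (convex_ball z (ψ τ)).isPreconnected
  have hne : (ball z (ψ τ) ∩ Ω).Nonempty :=
    mem_closure_iff.mp hw _ isOpen_ball (mem_ball.mpr hlt)
  refine hzΩ (hpre.subset_of_closure_inter_subset hΩo hne ?_ (mem_ball_self hψ0))
  rintro w' ⟨hw', hwb⟩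
  by_contra hn
  have hwf : w' ∈ frontier Ω := by
    rw [hΩo.frontier_eq]; exact ⟨hw', hn⟩
  rw [mem_ball] at hwb
  have hwr : w' ∈ ball y r := by
    rw [mem_ball]
    calc dist w' y ≤ dist w' z + dist z y := dist_triangle _ _ _
      _ < r := by linarith
  linarith [hbd w' hwf hwr]

end Exterior

/-! ### Short-time asymptotics -/

theorem ball_infDist_frontier_subset {V : Type*} [NormedAddCommGroup V] [NormedSpace ℝ V]
    {Ω : Set V} (hΩo : IsOpen Ω) {x : V} (hx : x ∈ Ω) : ball x (infDist x (frontier Ω)) ⊆ Ω := by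
  rcases (infDist_nonneg (x := x) (s := frontier Ω)).eq_or_lt with h | h
  · rw [← h, ball_zero]; exact empty_subset _
  refine (convex_ball x _).isPreconnected.subset_of_closure_inter_subset hΩo
    ⟨x, mem_ball_self h, hx⟩ ?_
  rintro w ⟨hw, hwb⟩
  by_contra hn
  have hwf : w ∈ frontier Ω := by
    rw [hΩo.frontier_eq]; exact ⟨hw, hn⟩
  have h1 := infDist_le_dist_of_mem (x := x) hwf
  rw [mem_ball, dist_comm] at hwb
  linarith

section Asymptotics

variable {N : ℕ} {p : ℝ} {Ω : Set (EuclideanSpace ℝ (Fin N))}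
  {u : EuclideanSpace ℝ (Fin N) → ℝ → ℝ}

theorem IsSolP.log_le (hN : 2 ≤ N) (hp : 1 < p) (hu : IsSolP p Ω u) (hΩo : IsOpen Ω)
    (hΓ : (frontier Ω).Nonempty)
    (hupos : ∀ x ∈ Ω, ∀ t : ℝ, 0 < t → 0 < u x t ∧ u x t < 1) {μ : ℝ}
    (hμ : μ = (N + p - 2) / (p - 1)) {x : EuclideanSpace ℝ (Fin N)} (hx : x ∈ Ω) {t : ℝ}
    (ht : 0 < t) :
    4 * t * Real.log (u x t) + p / (p - 1) * infDist x (frontier Ω) ^ 2 ≤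
      4 * t * (μ + 1 + μ * Real.log (μ + 1 +
        p / (p - 1) * infDist x (frontier Ω) ^ 2 / (2 * t))) := by
  have hp1 : 0 < p - 1 := by linarith
  have hN' : (2 : ℝ) ≤ N := by exact_mod_cast hN
  have hμ0 : 0 < μ := by
    rw [hμ]; exact div_pos (by linarith) hp1
  set d := infDist x (frontier Ω) with hd
  set c := p / (p - 1) with hc
  have hcpos : 0 < c := by positivity
  have hdpos : 0 < d := by
    refine (isClosed_frontier.notMem_iff_infDist_pos hΓ).mp fun h => ?_
    rw [hΩo.frontier_eq] at h
    exact h.2 hx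
  set a := c * d / (2 * t) with ha
  have hapos : 0 < a := by positivity
  have hsq : ∀ e : ℝ, 0 < Real.sqrt ((μ + 1) ^ 2 + a ^ 2 * e ^ 2) :=
    fun e => Real.sqrt_pos.mpr (by positivity)
  set h : ℝ → ℝ := fun e => a ^ 2 * (p - 1) / p * t +
      -(Real.sqrt ((μ + 1) ^ 2 + a ^ 2 * e ^ 2) -
          μ * Real.log (Real.sqrt ((μ + 1) ^ 2 + a ^ 2 * e ^ 2))) +
      (μ + 1 - μ * Real.log (μ + 1)) with hh
  have hcont : Continuous h := by
    have hlog : Continuous fun e : ℝ => Real.log (Real.sqrt ((μ + 1) ^ 2 + a ^ 2 * e ^ 2)) :=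
      Continuous.log (by fun_prop) fun e => (hsq e).ne'
    fun_prop
  have hle : Real.log (u x t) ≤ h d := by
    have hlim : Tendsto h (𝓝[<] d) (𝓝 (h d)) :=
      hcont.continuousAt.tendsto.mono_left nhdsWithin_le_nhds
    refine ge_of_tendsto hlim ?_
    filter_upwards [Ioo_mem_nhdsLT hdpos] with e he
    rw [Real.log_le_iff_le_exp (hupos x hx t ht).1]
    exact hu.le_exponential hN hp hΩo (fun y hy s hs => (hupos y hy s hs).2) hμ hapos he.1.le
      ((closedBall_subset_ball he.2).trans (ball_infDist_frontier_subset hΩo hx)) ht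
  have hlt : a ^ 2 * (p - 1) / p * t = c * d ^ 2 / (4 * t) := by
    rw [ha, hc]; field_simp; ring
  have had : a * d = c * d ^ 2 / (2 * t) := by rw [ha]; ring
  have hhalf : c * d ^ 2 / (2 * t) = 2 * (c * d ^ 2 / (4 * t)) := by field_simp; ring
  have hq1 : a * d ≤ Real.sqrt ((μ + 1) ^ 2 + a ^ 2 * d ^ 2) :=
    Real.le_sqrt_of_sq_le (by rw [mul_pow]; linarith [sq_nonneg (μ + 1)])
  have hq2 : Real.sqrt ((μ + 1) ^ 2 + a ^ 2 * d ^ 2) ≤ μ + 1 + a * d := by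
    have : 0 < a * d := by positivity
    refine Real.sqrt_le_iff.mpr ⟨by positivity, ?_⟩
    nlinarith
  have hlogq := mul_le_mul_of_nonneg_left (Real.log_le_log (hsq d) hq2) hμ0.le
  have hlogA : 0 ≤ μ * Real.log (μ + 1) := mul_nonneg hμ0.le (Real.log_nonneg (by linarith))
  simp only [hh] at hle
  rw [← had]
  have hfin : Real.log (u x t) + c * d ^ 2 / (4 * t) ≤
      μ + 1 + μ * Real.log (μ + 1 + a * d) := by linarith
  have := mul_le_mul_of_nonneg_left hfin (show 0 ≤ 4 * t by positivity)
  have e : 4 * t * (Real.log (u x t) + c * d ^ 2 / (4 * t)) =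
      4 * t * Real.log (u x t) + c * d ^ 2 := by field_simp
  linarith

theorem IsSolP.le_log (hN : 2 ≤ N) (hp : 1 < p) (hu : IsSolP p Ω u) (hΩo : IsOpen Ω)
    (hupos : ∀ x ∈ Ω, ∀ t : ℝ, 0 < t → 0 < u x t ∧ u x t < 1) {k ρ τ : ℝ}
    (hk : (N + p - 2) / (2 * (p - 1)) < k) (hk0 : 0 < k) (hρ : 0 < ρ)
    {x z : EuclideanSpace ℝ (Fin N)} (hx : x ∈ Ω) (hz : ∀ w ∈ closure Ω, ρ ≤ ‖w - z‖)
    (hxz : ‖x - z‖ ≤ infDist x (frontier Ω) + τ) {t : ℝ} (ht : 0 < t) :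
    4 * t * (k * (Real.log (p / (p - 1) / (4 * k)) + 2 * Real.log ρ - Real.log t)) -
      p / (p - 1) * (2 * infDist x (frontier Ω) * τ + τ ^ 2) ≤
      4 * t * Real.log (u x t) + p / (p - 1) * infDist x (frontier Ω) ^ 2 := by
  have hp1 : 0 < p - 1 := by linarith
  have h := hu.gaussian_le hN hp hΩo (fun y hy s hs => (hupos y hy s hs).1) hk hρ hz
    (subset_closure hx) ht
  rw [← Real.le_log_iff_exp_le (hupos x hx t ht).1] at h
  set d := infDist x (frontier Ω)
  set c := p / (p - 1) with hc
  have hcpos : 0 < c := by positivity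
  have hlog : Real.log (c * ρ ^ 2 / (4 * k)) = Real.log (c / (4 * k)) + 2 * Real.log ρ := by
    rw [mul_div_right_comm, Real.log_mul (by positivity) (by positivity), Real.log_pow]
    norm_num
  rw [hlog] at h
  have h1 := mul_le_mul_of_nonneg_left h (show 0 ≤ 4 * t by positivity)
  have e : 4 * t * (k * (Real.log (c / (4 * k)) + 2 * Real.log ρ - Real.log t) -
      c * ‖x - z‖ ^ 2 / (4 * t)) =
      4 * t * (k * (Real.log (c / (4 * k)) + 2 * Real.log ρ - Real.log t)) -
        c * ‖x - z‖ ^ 2 := by field_simp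
  have h2 : c * ‖x - z‖ ^ 2 ≤ c * (d + τ) ^ 2 := by gcongr
  nlinarith

end Asymptotics

/-- uniform short-time estimate
`|4t log u(x,t) + p' d_Γ(x)²| ≤ C t (1 + |log ψ(t)|)` on compact subsets of `Ω̄`, for a
domain of class `C^{0,ω}`; and, if `t log ψ(t) → 0`, uniform convergence of
`4t log u(x,t)` to `−p' d_Γ(x)²` on compact subsets of `Ω̄`. -/
theorem stmt10 (N : ℕ) (hN : 2 ≤ N) (p : ℝ) (hp : 1 < p)
    (Ω : Set (EuclideanSpace ℝ (Fin N))) (hΩo : IsOpen Ω) (hΩc : IsConnected Ω)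
    (hΓ : (frontier Ω).Nonempty)
    (ω : ℝ → ℝ) (hω0 : ω 0 = 0) (hωpos : ∀ s : ℝ, 0 < s → 0 < ω s)
    (hωmono : StrictMonoOn ω (Set.Ioi 0)) (hωcont : ContinuousOn ω (Set.Ioi 0))
    (hωlim : Filter.Tendsto ω (𝓝[>] (0:ℝ)) (𝓝 0))
    (r : ℝ) (iN : Fin N) (hiN : (iN : ℕ) = N - 1)
    (hreg : IsC0omega Ω ω r iN)
    (ψ : ℝ → ℝ)
    (hψ : ∀ t : ℝ, ψ t = sInf ((fun s => Real.sqrt (s^2 + (t - ω s)^2)) '' Set.Icc 0 r))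
    (u : EuclideanSpace ℝ (Fin N) → ℝ → ℝ) (hu : IsSolP p Ω u)
    (hupos : ∀ x ∈ Ω, ∀ t : ℝ, 0 < t → 0 < u x t ∧ u x t < 1) :
    (∀ K : Set (EuclideanSpace ℝ (Fin N)), IsCompact K → K ⊆ closure Ω →
      ∃ C : ℝ, 0 < C ∧ ∃ t₀ : ℝ, 0 < t₀ ∧ ∀ x ∈ K, ∀ t : ℝ, 0 < t → t < t₀ →
        |4 * t * Real.log (u x t) + (p/(p-1)) * (Metric.infDist x (frontier Ω))^2| ≤
          C * t * (1 + |Real.log (ψ t)|)) ∧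
    (Filter.Tendsto (fun t => t * Real.log (ψ t)) (𝓝[>] (0:ℝ)) (𝓝 0) →
      ∀ K : Set (EuclideanSpace ℝ (Fin N)), IsCompact K → K ⊆ closure Ω →
        TendstoUniformlyOn (fun (t : ℝ) (x : EuclideanSpace ℝ (Fin N)) =>
            4 * t * Real.log (u x t))
          (fun x => -(p/(p-1)) * (Metric.infDist x (frontier Ω))^2) (𝓝[>] (0:ℝ)) K) := by
  have hr : 0 < r := hreg.1
  have hωc := continuousOn_modulus hω0 hωcont hωlim
  have hp1 : 0 < p - 1 := by linarith
  have hN' : (2 : ℝ) ≤ N := by exact_mod_cast hN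
  have main : ∀ K : Set (EuclideanSpace ℝ (Fin N)), IsCompact K → K ⊆ closure Ω →
      ∃ C : ℝ, 0 < C ∧ ∃ t₀ : ℝ, 0 < t₀ ∧ ∀ x ∈ K, ∀ t : ℝ, 0 < t → t < t₀ →
        |4 * t * Real.log (u x t) + (p/(p-1)) * (Metric.infDist x (frontier Ω))^2| ≤
          C * t * (1 + |Real.log (ψ t)|) := by
    intro K hK hKΩ
    obtain ⟨D₀, hD₀⟩ := hK.exists_bound_of_continuousOn
      (continuous_infDist_pt (frontier Ω)).continuousOn
    set D := |D₀| with hD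
    have hD0 : 0 ≤ D := abs_nonneg _
    have hdD : ∀ x ∈ K, infDist x (frontier Ω) ≤ D := fun x hx =>
      (le_abs_self _).trans ((hD₀ x hx).trans (le_abs_self _))
    set c := p / (p - 1) with hc
    have hcpos : 0 < c := by positivity
    obtain ⟨μ, hμ⟩ : ∃ μ : ℝ, μ = (N + p - 2) / (p - 1) := ⟨_, rfl⟩
    have hμ0 : 0 < μ := by
      rw [hμ]; exact div_pos (by linarith) hp1
    obtain ⟨k, hk⟩ : ∃ k : ℝ, k = (N + p - 2) / (2 * (p - 1)) + 1 := ⟨_, rfl⟩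
    have hk0 : 0 < k := by
      have : 0 ≤ ((N : ℝ) + p - 2) / (2 * (p - 1)) := div_nonneg (by linarith) (by linarith)
      linarith
    set Clow := 4 * k * |Real.log (c / (4 * k))| + 8 * k + c * (2 * D + 1) with hClow
    set Cup := 4 * (μ + 1 + μ * Real.log (μ + 1 + c * D ^ 2)) + 4 * μ with hCup
    have hlogpos : 0 ≤ Real.log (μ + 1 + c * D ^ 2) :=
      Real.log_nonneg (by nlinarith [mul_nonneg hcpos.le (sq_nonneg D)])
    have hClow0 : 0 < Clow := by positivity
    have hCup0 : 0 < Cup := by positivity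
    refine ⟨Clow + Cup, by positivity, min 1 (r / 2), by positivity, fun x hx t ht htt => ?_⟩
    have ht1 : t < 1 := htt.trans_le (min_le_left _ _)
    have htr : 2 * t ≤ r := by linarith [htt.trans_le (min_le_right _ _)]
    by_cases hxΩ : x ∈ Ω
    swap
    · have hxf : x ∈ frontier Ω := by
        rw [hΩo.frontier_eq]; exact ⟨hKΩ hx, hxΩ⟩
      rw [hu.2.2.2.2 x hxf t ht, infDist_zero_of_mem hxf]
      simp only [Real.log_one, mul_zero, ne_eq, OfNat.ofNat_ne_zero, not_false_eq_true, zero_pow,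
        add_zero, abs_zero]
      positivity
    have hρ := psi_pos hψ hω0 hωc hr ht
    have hρt := psi_le_self hψ hω0 hr ht
    have hlogt : Real.log t < 0 := Real.log_neg ht ht1
    have hlogρ : Real.log (ψ t) ≤ Real.log t := Real.log_le_log hρ hρt
    set L := |Real.log (ψ t)| with hL
    have hLeq : L = -Real.log (ψ t) := abs_of_nonpos (by linarith)
    have hL0 : 0 ≤ L := abs_nonneg _
    have hd := hdD x hx
    have hd0 : 0 ≤ infDist x (frontier Ω) := infDist_nonneg
    have hlow : -(Clow * t * (1 + L)) ≤
        4 * t * Real.log (u x t) + c * infDist x (frontier Ω) ^ 2 := by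
      obtain ⟨y, hy, hxy⟩ := isClosed_frontier.exists_infDist_eq_dist hΓ x
      obtain ⟨z, hzy, hz⟩ := hreg.exists_exterior_ball hiN hΩo hψ hω0 hωc hy ht htr
      have hxz : ‖x - z‖ ≤ infDist x (frontier Ω) + t := by
        rw [← dist_eq_norm, hxy, ← hzy, dist_comm z y]
        exact dist_triangle _ _ _
      refine le_trans ?_ (hu.le_log hN hp hΩo hupos (by linarith) hk0 hρ hxΩ hz hxz ht)
      have h1 : -(|Real.log (c / (4 * k))| + 2 * L) ≤
          Real.log (c / (4 * k)) + 2 * Real.log (ψ t) - Real.log t := by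
        linarith [neg_abs_le (Real.log (c / (4 * k)))]
      have h2 := mul_le_mul_of_nonneg_left h1 (show 0 ≤ 4 * t * k by positivity)
      have h3 : c * (2 * infDist x (frontier Ω) * t + t ^ 2) ≤ c * ((2 * D + 1) * t) := by
        have h4 : infDist x (frontier Ω) * t ≤ D * t := by gcongr
        have h5 : t ^ 2 ≤ t := by nlinarith
        exact mul_le_mul_of_nonneg_left (by linarith) hcpos.le
      have h6 : Clow * t * (1 + L) = 4 * t * k * (|Real.log (c / (4 * k))| + 2 * L) +
          c * ((2 * D + 1) * t) +
          t * (4 * k * |Real.log (c / (4 * k))| * L + 8 * k + c * (2 * D + 1) * L) := by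
        rw [hClow]; ring
      have h7 : 0 ≤ t * (4 * k * |Real.log (c / (4 * k))| * L + 8 * k + c * (2 * D + 1) * L) := by
        positivity
      linarith
    have hup : 4 * t * Real.log (u x t) + c * infDist x (frontier Ω) ^ 2 ≤
        Cup * t * (1 + L) := by
      refine (hu.log_le hN hp hΩo hΓ hupos hμ hxΩ ht).trans ?_
      have h1 : μ + 1 + c * infDist x (frontier Ω) ^ 2 / (2 * t) ≤ (μ + 1 + c * D ^ 2) / t := by
        rw [le_div_iff₀ ht]
        have h2 : (μ + 1 + c * infDist x (frontier Ω) ^ 2 / (2 * t)) * t =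
            (μ + 1) * t + c * infDist x (frontier Ω) ^ 2 / 2 := by field_simp
        have h3 : c * infDist x (frontier Ω) ^ 2 ≤ c * D ^ 2 := by gcongr
        have h4 : 0 ≤ c * D ^ 2 := by positivity
        rw [h2]
        nlinarith
      have h5 := Real.log_le_log (by positivity) h1
      rw [Real.log_div (by positivity) ht.ne'] at h5
      have h6 : Real.log (μ + 1 + c * infDist x (frontier Ω) ^ 2 / (2 * t)) ≤
          Real.log (μ + 1 + c * D ^ 2) + L := by linarith
      have h7 := mul_le_mul_of_nonneg_left h6 (show 0 ≤ 4 * t * μ by positivity)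
      have h8 : Cup * t * (1 + L) = 4 * t * (μ + 1) +
          4 * t * μ * (Real.log (μ + 1 + c * D ^ 2) + L) +
          t * (4 * (μ + 1 + μ * Real.log (μ + 1 + c * D ^ 2)) * L + 4 * μ) := by
        rw [hCup]; ring
      have h9 : 0 ≤ t * (4 * (μ + 1 + μ * Real.log (μ + 1 + c * D ^ 2)) * L + 4 * μ) := by
        positivity
      linarith
    have hpos1 : 0 ≤ Clow * t * (1 + L) := by positivity
    have hpos2 : 0 ≤ Cup * t * (1 + L) := by positivity
    rw [abs_le]
    constructor <;> linarith
  refine ⟨main, fun hlim K hK hKΩ => ?_⟩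
  obtain ⟨C, hC, t₀, ht₀, hest⟩ := main K hK hKΩ
  rw [Metric.tendstoUniformlyOn_iff]
  intro ε hε
  have hbound : Tendsto (fun t => C * (t + |t * Real.log (ψ t)|)) (𝓝[>] (0 : ℝ)) (𝓝 0) := by
    have hid : Tendsto (fun t : ℝ => t) (𝓝[>] (0 : ℝ)) (𝓝 0) :=
      tendsto_id.mono_left nhdsWithin_le_nhds
    simpa using (hid.add hlim.abs).const_mul C
  filter_upwards [hbound.eventually (gt_mem_nhds hε), Ioo_mem_nhdsGT ht₀] with t ht1 ht2 x hx
  have h := hest x hx t ht2.1 ht2.2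
  rw [abs_mul, abs_of_pos ht2.1] at ht1
  rw [dist_comm, Real.dist_eq]
  calc |4 * t * Real.log (u x t) - -(p / (p - 1)) * infDist x (frontier Ω) ^ 2|
      = |4 * t * Real.log (u x t) + p / (p - 1) * infDist x (frontier Ω) ^ 2| := by
        congr 1; ring
    _ ≤ C * t * (1 + |Real.log (ψ t)|) := h
    _ = C * (t + t * |Real.log (ψ t)|) := by ring
    _ < ε := ht1

end
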